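/- arXiv:math/0011154 — 2 statements merged into one kernel-verified Lean document; each statement's English description precedes it below -/
import Mathlib

section
/- Let K be a field, V a K-vector space of finite dimension r + 1 with r ≥ 1, and S ⊆ ℙ(V) a finite set of cardinality at least r + 1 in general linear position. Let P ∈ S. Then the intersection of the submodules span(A), taken over all subsets A ⊆ S with |A| = r and P ∈ A, equals the line span({P}) corresponding to P. -/
/-- The submodule of `V` spanned by the lines corresponding to a finite set of
points of the projectivization `ℙ K V`. -/
def pspan (K : Type*) {V : Type*} [Field K] [AddCommGroup V] [Module K V]
    (A : Finset (Projectivization K V)) : Submodule K V :=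
  ⨆ P ∈ A, P.submodule

/-- A finite set `S ⊆ ℙ K V` is in general linear position (with respect to `r`,
where `finrank K V = r + 1`) if every subset `T ⊆ S` with `|T| ≤ r + 1` spans a
submodule of dimension `|T|`. -/
def InGenLinPos (K : Type*) {V : Type*} [Field K] [AddCommGroup V] [Module K V]
    (r : ℕ) (S : Finset (Projectivization K V)) : Prop :=
  ∀ T ⊆ S, T.card ≤ r + 1 → Module.finrank K (pspan K T) = T.card

theorem pspan_mono {K V : Type*} [Field K] [AddCommGroup V] [Module K V]
    {A B : Finset (Projectivization K V)} (h : A ⊆ B) : pspan K A ≤ pspan K B :=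
  biSup_mono h

theorem pspan_singleton {K V : Type*} [Field K] [AddCommGroup V] [Module K V]
    (P : Projectivization K V) : pspan K {P} = P.submodule := by
  simp [pspan]

theorem pspan_union {K V : Type*} [Field K] [AddCommGroup V] [Module K V]
    [DecidableEq (Projectivization K V)] (A B : Finset (Projectivization K V)) :
    pspan K (A ∪ B) = pspan K A ⊔ pspan K B :=
  Finset.iSup_union

/-- Inside a general position set, spans commute with intersections as long as the union of the
two subsets is small enough to be independent. -/
theorem InGenLinPos.pspan_inter {K V : Type*} [Field K] [AddCommGroup V] [Module K V]
    [FiniteDimensional K V] [DecidableEq (Projectivization K V)]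
    {r : ℕ} {S A B : Finset (Projectivization K V)} (hS : InGenLinPos K r S)
    (hAB : A ∪ B ⊆ S) (hcard : (A ∪ B).card ≤ r + 1) :
    pspan K (A ∩ B) = pspan K A ⊓ pspan K B := by
  have key {C : Finset (Projectivization K V)} (hC : C ⊆ A ∪ B) :
      Module.finrank K (pspan K C) = C.card :=
    hS C (hC.trans hAB) ((Finset.card_le_card hC).trans hcard)
  refine Submodule.eq_of_le_of_finrank_eq
    (le_inf (pspan_mono Finset.inter_subset_left) (pspan_mono Finset.inter_subset_right)) ?_
  have hdim := Submodule.finrank_sup_add_finrank_inf_eq (pspan K A) (pspan K B)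
  rw [← pspan_union, key subset_rfl, key Finset.subset_union_left,
    key Finset.subset_union_right] at hdim
  rw [key (Finset.inter_subset_left.trans Finset.subset_union_left)]
  have := Finset.card_union_add_card_inter A B
  omega

theorem point_is_intersection_of_hyperplanes
    {K V : Type*} [Field K] [AddCommGroup V] [Module K V]
    (r : ℕ) (hr : 1 ≤ r) (hdim : Module.finrank K V = r + 1)
    (S : Finset (Projectivization K V)) (hScard : r + 1 ≤ S.card)
    (hS : InGenLinPos K r S)
    (P : Projectivization K V) (hP : P ∈ S) :
    (⨅ A : {A : Finset (Projectivization K V) // A ⊆ S ∧ A.card = r ∧ P ∈ A},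
      pspan K A.1) = P.submodule := by
  classical
  have : FiniteDimensional K V := Module.finite_of_finrank_pos (by omega)
  refine le_antisymm ?_ (le_iInf fun A => ?_)
  · obtain ⟨T, hPT, hTS, hT⟩ := Finset.exists_subsuperset_card_eq
      (Finset.singleton_subset_iff.2 hP) (by simp) hScard
    rw [Finset.singleton_subset_iff] at hPT
    have hsdiff : ∀ U ⊆ T.erase P,
        (⨅ A : {A : Finset (Projectivization K V) // A ⊆ S ∧ A.card = r ∧ P ∈ A},
          pspan K A.1) ≤ pspan K (T \ U) := by
      intro U
      induction U using Finset.induction_on with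
      | empty =>
        intro _
        have htop : pspan K T = ⊤ :=
          Submodule.eq_top_of_finrank_eq (by rw [hS T hTS hT.le, hT, hdim])
        simp [htop]
      | insert Q U _ ih =>
        intro hU
        rw [Finset.insert_subset_iff, Finset.mem_erase] at hU
        obtain ⟨⟨hQP, hQT⟩, hU⟩ := hU
        have hsub : T \ U ∪ T.erase Q ⊆ T :=
          Finset.union_subset Finset.sdiff_subset (Finset.erase_subset Q T)
        have hinter : T \ insert Q U = (T \ U) ∩ T.erase Q := by grind
        rw [hinter, hS.pspan_inter (hsub.trans hTS) ((Finset.card_le_card hsub).trans hT.le)]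
        refine le_inf (ih hU) (iInf_le_of_le ⟨T.erase Q, (Finset.erase_subset Q T).trans hTS,
          ?_, Finset.mem_erase.2 ⟨hQP.symm, hPT⟩⟩ le_rfl)
        rw [Finset.card_erase_of_mem hQT, hT, Nat.add_sub_cancel]
    have hP' : T \ T.erase P = {P} := by grind
    rw [← pspan_singleton P, ← hP']
    exact hsdiff _ subset_rfl
  · rw [← pspan_singleton P]
    exact pspan_mono (Finset.singleton_subset_iff.2 A.2.2.2)
end

section
/- Let K be a field, V a K-vector space of finite dimension r + 1 with r ≥ 2, and S ⊆ ℙ(V) a finite set in general linear position. Let N, A, A′ ⊆ S each have cardinality r, and suppose span(A) ≠ span(A′), span(A) ≠ span(N), span(A′) ≠ span(N), and span(N) ⊓ span(A) = span(N) ⊓ span(A′) (intersection of submodules). Then A ∩ A′ ⊆ N, i.e. every point common to A and A′ belongs to N. -/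
theorem pspan_insert (K : Type*) {V : Type*} [Field K] [AddCommGroup V] [Module K V]
    [DecidableEq (Projectivization K V)]
    (P : Projectivization K V) (A : Finset (Projectivization K V)) :
    pspan K (insert P A) = P.submodule ⊔ pspan K A :=
  Finset.iSup_insert P A _

theorem submodule_le_pspan {K V : Type*} [Field K] [AddCommGroup V] [Module K V]
    {P : Projectivization K V} {A : Finset (Projectivization K V)} (hP : P ∈ A) :
    P.submodule ≤ pspan K A :=
  le_iSup₂_of_le P hP le_rfl

/-- In general linear position, a point outside `r` given points of `S` spans, together with
them, the whole space. -/
theorem InGenLinPos.submodule_sup_pspan_eq_top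
    {K V : Type*} [Field K] [AddCommGroup V] [Module K V] {r : ℕ}
    {S N : Finset (Projectivization K V)} {P : Projectivization K V}
    (hS : InGenLinPos K r S) (hdim : Module.finrank K V = r + 1)
    (hNS : N ⊆ S) (hN : N.card = r) (hPS : P ∈ S) (hPN : P ∉ N) :
    P.submodule ⊔ pspan K N = ⊤ := by
  classical
  have : FiniteDimensional K V := Module.finite_of_finrank_pos (by omega)
  have hcard : (insert P N).card = r + 1 := by rw [Finset.card_insert_of_notMem hPN, hN]
  rw [← pspan_insert]
  apply Submodule.eq_top_of_finrank_eq
  rw [hS _ (Finset.insert_subset hPS hNS) hcard.le, hcard, hdim]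

/-- In a modular lattice, an element `a` above `p` is recovered from `p` and `n ⊓ a` when `p` and
`n` are codisjoint. -/
theorem sup_inf_eq_of_sup_eq_top {α : Type*} [Lattice α] [IsModularLattice α] [OrderTop α]
    {p n a : α} (htop : p ⊔ n = ⊤) (hpa : p ≤ a) : p ⊔ n ⊓ a = a := by
  rw [← sup_inf_assoc_of_le n hpa, htop, top_inf_eq]

theorem inter_subset_of_eq_trace
    {K V : Type*} [Field K] [AddCommGroup V] [Module K V]
    (r : ℕ) (hr : 2 ≤ r) (hdim : Module.finrank K V = r + 1)
    (S : Finset (Projectivization K V)) (hS : InGenLinPos K r S)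
    (N A A' : Finset (Projectivization K V))
    (hNS : N ⊆ S) (hAS : A ⊆ S) (hA'S : A' ⊆ S)
    (hN : N.card = r) (hA : A.card = r) (hA' : A'.card = r)
    (hAA' : pspan K A ≠ pspan K A')
    (hAN : pspan K A ≠ pspan K N)
    (hA'N : pspan K A' ≠ pspan K N)
    (htrace : pspan K N ⊓ pspan K A = pspan K N ⊓ pspan K A') :
    ∀ P, P ∈ A → P ∈ A' → P ∈ N := by
  intro P hPA hPA'
  by_contra hPN
  have htop := hS.submodule_sup_pspan_eq_top hdim hNS hN (hAS hPA) hPN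
  apply hAA'
  rw [← sup_inf_eq_of_sup_eq_top htop (submodule_le_pspan hPA), htrace,
    sup_inf_eq_of_sup_eq_top htop (submodule_le_pspan hPA')]
end
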